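/- arXiv:2205.08528 — 2 statements merged into one kernel-verified Lean document; each statement's English description precedes it below -/
import Mathlib

section
/- Let S be a subdivision of [0,1] with ordered knots 0 = t_(1) < ... < t_(m) = 1 (m ≥ 2) and hat basis functions φ_1, ..., φ_m. Let t ∈ (0,1) with t ∉ S, and let ν ∈ {1, ..., m-1} be such that t_(ν) < t < t_(ν+1). Let S̃ = S ∪ {t}, with hat basis functions φ̃_1, ..., φ̃_{m+1}. Given coefficients c_1, ..., c_m ∈ ℝ, define c̄_1, ..., c̄_{m+1} by c̄_j = c_j for j ≤ ν, c̄_j = c_{j-1} for j ≥ ν+2, and c̄_{ν+1} = c_ν · (t_(ν+1) - t)/(t_(ν+1) - t_(ν)) + c_{ν+1} · (t - t_(ν))/(t_(ν+1) - t_(ν)). Then Σ_{j=1}^m c_j φ_j(x) = Σ_{j=1}^{m+1} c̄_j φ̃_j(x) for all x ∈ [0,1]. -/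
open MeasureTheory

/-- The hat function with nodes `u < v < w`. -/
noncomputable def hatFn (u v w t : ℝ) : ℝ :=
  if u ≤ t ∧ t ≤ v then (t - u) / (v - u)
  else if v ≤ t ∧ t ≤ w then (w - t) / (w - v)
  else 0

/-- The hat basis function centered at the `j`-th knot of the subdivision with
ordered knots `u 1 < ... < u m` (conventions `u 0 = -1`, `u (m+1) = 2`). -/
noncomputable def hatBasis (u : ℕ → ℝ) (j : ℕ) (t : ℝ) : ℝ :=
  hatFn (u (j - 1)) (u j) (u (j + 1)) t

theorem hatFn_of_le_left {u v w x : ℝ} (huv : u < v) (hx : x ≤ u) : hatFn u v w x = 0 := by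
  unfold hatFn
  split_ifs with h₁ h₂
  · rw [le_antisymm hx h₁.1, sub_self, zero_div]
  · linarith [h₂.1]
  · rfl

theorem hatFn_of_right_le {u v w x : ℝ} (hvw : v < w) (hx : w ≤ x) : hatFn u v w x = 0 := by
  unfold hatFn
  split_ifs with h₁ h₂
  · linarith [h₁.2]
  · rw [le_antisymm hx h₂.2, sub_self, zero_div]
  · rfl

theorem hatFn_of_mem_left {u v w x : ℝ} (h₁ : u ≤ x) (h₂ : x ≤ v) :
    hatFn u v w x = (x - u) / (v - u) :=
  if_pos ⟨h₁, h₂⟩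

theorem hatFn_of_mem_right {u v w x : ℝ} (huv : u < v) (hvw : v < w) (h₁ : v ≤ x) (h₂ : x ≤ w) :
    hatFn u v w x = (w - x) / (w - v) := by
  unfold hatFn
  split_ifs with h h'
  · rw [le_antisymm h.2 h₁, div_self (sub_pos.2 huv).ne', div_self (sub_pos.2 hvw).ne']
  · rfl
  · exact absurd ⟨h₁, h₂⟩ h'

theorem le_of_forall_lt_succ {n : ℕ} {u : ℕ → ℝ} (hu : ∀ j ≤ n, u j < u (j + 1)) {i j : ℕ}
    (hij : i ≤ j) (hj : j ≤ n + 1) : u i ≤ u j := by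
  induction j, hij using Nat.le_induction with
  | base => exact le_rfl
  | succ k _ ih => exact (ih (by omega)).trans (hu k (by omega)).le

/-- Between two consecutive knots, a combination of hat basis functions is the linear
interpolation of the two corresponding coefficients. -/
theorem sum_mul_hatBasis {n : ℕ} {u : ℕ → ℝ} (hu : ∀ j ≤ n, u j < u (j + 1)) (c : ℕ → ℝ)
    {k : ℕ} (hk : 1 ≤ k) (hkn : k < n) {x : ℝ} (h₁ : u k ≤ x) (h₂ : x ≤ u (k + 1)) :
    ∑ j ∈ Finset.Icc 1 n, c j * hatBasis u j x =
      c k * ((u (k + 1) - x) / (u (k + 1) - u k)) +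
        c (k + 1) * ((x - u k) / (u (k + 1) - u k)) := by
  have hpred : ∀ j, 1 ≤ j → j ≤ n → u (j - 1) < u j := by
    intro j hj hjn
    simpa [Nat.sub_add_cancel hj] using hu (j - 1) (by omega)
  have hleft : hatBasis u k x = (u (k + 1) - x) / (u (k + 1) - u k) :=
    hatFn_of_mem_right (hpred k hk hkn.le) (hu k hkn.le) h₁ h₂
  have hright : hatBasis u (k + 1) x = (x - u k) / (u (k + 1) - u k) :=
    hatFn_of_mem_left h₁ h₂
  rw [← hleft, ← hright]
  refine Finset.sum_eq_add_of_mem k (k + 1) (by simp; omega) (by simp; omega) (by omega) ?_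
  rintro j hj ⟨hjk, hjk'⟩
  rw [Finset.mem_Icc] at hj
  refine mul_eq_zero_of_right _ ?_
  rcases lt_or_gt_of_ne hjk with h | h
  · exact hatFn_of_right_le (hu j hj.2) ((le_of_forall_lt_succ hu h (by omega)).trans h₁)
  · exact hatFn_of_le_left (hpred j hj.1 hj.2)
      (h₂.trans (le_of_forall_lt_succ hu (by omega) (by omega)))

theorem exists_mem_knot_interval {n : ℕ} (hn : 2 ≤ n) {u : ℕ → ℝ} {x : ℝ} (h₁ : u 1 ≤ x)
    (h₂ : x ≤ u n) : ∃ k, 1 ≤ k ∧ k < n ∧ u k ≤ x ∧ x ≤ u (k + 1) := by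
  induction n, hn using Nat.le_induction with
  | base => exact ⟨1, le_rfl, one_lt_two, h₁, h₂⟩
  | succ n hn ih =>
    rcases le_total x (u n) with h | h
    · obtain ⟨k, hk, hkn, hx⟩ := ih h
      exact ⟨k, hk, hkn.trans n.lt_succ_self, hx⟩
    · exact ⟨n, by omega, n.lt_succ_self, h, h₂⟩

theorem stmt9 (m : ℕ) (hm : 2 ≤ m) (u : ℕ → ℝ)
    (hu0 : u 0 = -1) (hu1 : u 1 = 0) (hum : u m = 1) (hum1 : u (m + 1) = 2)
    (humono : ∀ j, 1 ≤ j → j < m → u j < u (j + 1))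
    (t : ℝ) (ν : ℕ) (hν1 : 1 ≤ ν) (hν2 : ν ≤ m - 1)
    (ht : u ν < t ∧ t < u (ν + 1))
    (ut : ℕ → ℝ)
    (hut : ∀ j, ut j = if j ≤ ν then u j else if j = ν + 1 then t else u (j - 1))
    (c : ℕ → ℝ) (cb : ℕ → ℝ)
    (hcb : ∀ j, cb j = if j ≤ ν then c j
      else if j = ν + 1 then
        c ν * ((u (ν + 1) - t) / (u (ν + 1) - u ν)) +
          c (ν + 1) * ((t - u ν) / (u (ν + 1) - u ν))
      else c (j - 1)) :
    ∀ x ∈ Set.Icc (0:ℝ) 1,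
      (∑ j ∈ Finset.Icc 1 m, c j * hatBasis u j x) =
        ∑ j ∈ Finset.Icc 1 (m + 1), cb j * hatBasis ut j x := by
  rintro x ⟨hx0, hx1⟩
  have hu : ∀ j ≤ m, u j < u (j + 1) := by
    intro j hj
    rcases Nat.eq_zero_or_pos j with rfl | hj0
    · norm_num [hu0, hu1]
    · rcases hj.lt_or_eq with h | rfl
      · exact humono j hj0 h
      · norm_num [hum, hum1]
  have hut_le : ∀ j ≤ ν, ut j = u j := fun j hj => by rw [hut, if_pos hj]
  have hut_mid : ut (ν + 1) = t := by simp [hut]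
  have hut_gt : ∀ j, ν < j → ut (j + 1) = u j := fun j hj => by
    rw [hut, if_neg (by omega), if_neg (by omega), Nat.add_sub_cancel]
  have hcb_le : ∀ j ≤ ν, cb j = c j := fun j hj => by rw [hcb, if_pos hj]
  have hcb_mid : cb (ν + 1) = c ν * ((u (ν + 1) - t) / (u (ν + 1) - u ν)) +
      c (ν + 1) * ((t - u ν) / (u (ν + 1) - u ν)) := by simp [hcb]
  have hcb_gt : ∀ j, ν < j → cb (j + 1) = c j := fun j hj => by
    rw [hcb, if_neg (by omega), if_neg (by omega), Nat.add_sub_cancel]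
  have hut_lt : ∀ j ≤ m + 1, ut j < ut (j + 1) := by
    intro j hj
    rcases lt_trichotomy j ν with h | rfl | h
    · rw [hut_le j h.le, hut_le (j + 1) h]
      exact hu j (by omega)
    · rw [hut_le j le_rfl, hut_mid]
      exact ht.1
    · obtain ⟨i, rfl⟩ : ∃ i, j = i + 1 := ⟨j - 1, by omega⟩
      rcases (Nat.lt_succ_iff.1 h).eq_or_lt with rfl | h'
      · rw [hut_mid, hut_gt _ (Nat.lt_succ_self _)]
        exact ht.2
      · rw [hut_gt i h', hut_gt (i + 1) h]
        exact hu i (by omega)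
  obtain ⟨k, hk, hkm, h₁, h₂⟩ :=
    exists_mem_knot_interval hm (hu1.trans_le hx0) (hx1.trans_eq hum.symm)
  rw [sum_mul_hatBasis hu c hk hkm h₁ h₂]
  rcases lt_trichotomy k ν with h | rfl | h
  · have e₁ := hut_le k h.le
    have e₂ := hut_le (k + 1) h
    rw [sum_mul_hatBasis hut_lt cb hk (by omega) (e₁.trans_le h₁) (h₂.trans_eq e₂.symm), e₁, e₂,
      hcb_le k h.le, hcb_le (k + 1) h]
  · have e₁ := hut_le k le_rfl
    have e₂ := hut_gt (k + 1) k.lt_succ_self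
    have n₀ : u (k + 1) - u k ≠ 0 := (sub_pos.2 (ht.1.trans ht.2)).ne'
    have n₁ : t - u k ≠ 0 := (sub_pos.2 ht.1).ne'
    have n₂ : u (k + 1) - t ≠ 0 := (sub_pos.2 ht.2).ne'
    rcases le_total x t with hxt | hxt
    · rw [sum_mul_hatBasis hut_lt cb hk (by omega) (e₁.trans_le h₁) (hxt.trans_eq hut_mid.symm),
        e₁, hut_mid, hcb_le k le_rfl, hcb_mid]
      field_simp
      ring
    · rw [sum_mul_hatBasis hut_lt cb (k := k + 1) (by omega) (by omega) (hut_mid.trans_le hxt)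
        (h₂.trans_eq e₂.symm), e₂, hut_mid, hcb_gt (k + 1) k.lt_succ_self, hcb_mid]
      field_simp
      ring
  · have e₁ := hut_gt k h
    have e₂ := hut_gt (k + 1) (by omega)
    rw [sum_mul_hatBasis hut_lt cb (k := k + 1) (by omega) (by omega) (e₁.trans_le h₁)
      (h₂.trans_eq e₂.symm), e₁, e₂, hcb_gt k h, hcb_gt (k + 1) (by omega)]
end

section
/- (Proposition 1.) Let J be a finite index set, and for each i ∈ J let S_i be a subdivision of [0,1] with m_i ≥ 2 ordered knots and hat basis functions φ_{i,1}, ..., φ_{i,m_i}; let E^{(S_i)}_j := ∫_0^1 φ_{i,j}(t) dt and E^{(S_i)}_{j,j'} := ∫_0^1 φ_{i,j}(t) φ_{i,j'}(t) dt. Let i* ∉ J be a new index with φ_{i*,1}(u) = 1-u and φ_{i*,2}(u) = u for u ∈ [0,1]. Given real coefficients η_{i,j} (for i ∈ J, 1 ≤ j ≤ m_i) and real numbers ξ̃_{i*,1}, ξ̃_{i*,2}, set η_{i*} = ξ̃_{i*,2} − ξ̃_{i*,1} and ζ_{i*} = ξ̃_{i*,1} + ξ̃_{i*,2}. Then the integral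 over the cube [0,1]^{|J|+1} (with coordinates x_i for i ∈ J ∪ {i*}) of ( Σ_{i∈J} Σ_{j=1}^{m_i} η_{i,j} φ_{i,j}(x_i) − Σ_{j=1}^2 ξ̃_{i*,j} φ_{i*,j}(x_{i*}) )^2 equals Σ_{i∈J} Σ_{j,j'=1, |j-j'|≤1}^{m_i} η_{i,j} η_{i,j'} E^{(S_i)}_{j,j'} − Σ_{i∈J} ( Σ_{j=1}^{m_i} η_{i,j} E^{(S_i)}_j )^2 + η_{i*}^2/12 + ( Σ_{i∈J} Σ_{j=1}^{m_i} η_{i,j} E^{(S_i)}_j − ζ_{i*}/2 )^2. -/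
open MeasureTheory

theorem hatFn_eq_zero_of_le {u v w t : ℝ} (huv : u < v) (h : t ≤ u) :
    hatFn u v w t = 0 := by
  unfold hatFn
  split_ifs with h1 h2
  · rw [le_antisymm h h1.1, sub_self, zero_div]
  · linarith [h2.1]
  · rfl

theorem hatFn_eq_zero_of_ge {u v w t : ℝ} (hvw : v < w) (h : w ≤ t) :
    hatFn u v w t = 0 := by
  unfold hatFn
  split_ifs with h1 h2
  · linarith [h1.2]
  · rw [le_antisymm h2.2 h, sub_self, zero_div]
  · rfl

theorem abs_hatFn_le_one (u v w t : ℝ) : |hatFn u v w t| ≤ 1 := by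
  unfold hatFn
  split_ifs with h1 h2
  · rw [abs_of_nonneg (div_nonneg (by linarith) (by linarith))]
    exact div_le_one_of_le₀ (by linarith) (by linarith)
  · rw [abs_of_nonneg (div_nonneg (by linarith) (by linarith))]
    exact div_le_one_of_le₀ (by linarith) (by linarith)
  · simp

theorem measurable_hatFn (u v w : ℝ) : Measurable (hatFn u v w) := by
  unfold hatFn
  refine Measurable.ite measurableSet_Icc (by fun_prop) ?_
  exact Measurable.ite measurableSet_Icc (by fun_prop) measurable_const

theorem memLp_hatBasis (u : ℕ → ℝ) (j : ℕ) (p : ENNReal) (μ : Measure ℝ) [IsFiniteMeasure μ] :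
    MemLp (hatBasis u j) p μ :=
  MemLp.of_bound (measurable_hatFn _ _ _).aestronglyMeasurable 1
    (Filter.Eventually.of_forall fun _ => abs_hatFn_le_one _ _ _ _)

theorem hatBasis_mul_hatBasis_eq_zero {u : ℕ → ℝ} {n j k : ℕ}
    (hu : ∀ l < n, u l < u (l + 1)) (hj : 1 ≤ j) (hjk : j + 2 ≤ k) (hk : k < n) (t : ℝ) :
    hatBasis u j t * hatBasis u k t = 0 := by
  have step : ∀ l, 1 ≤ l → l < n → u (l - 1) < u l := fun l h1 h2 => by
    simpa [Nat.sub_add_cancel h1] using hu (l - 1) (by omega)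
  have hmono : ∀ l, j + 1 ≤ l → l ≤ n → u (j + 1) ≤ u l := fun l hl => by
    induction l, hl using Nat.le_induction with
    | base => exact fun _ => le_rfl
    | succ l _ ih => exact fun h => (ih (by omega)).trans (hu l (by omega)).le
  have hmid : u (j + 1) ≤ u (k - 1) := hmono _ (by omega) (by omega)
  rcases le_total t (u (k - 1)) with h | h
  · exact mul_eq_zero_of_right _
      (hatFn_eq_zero_of_le (step k (by omega) hk) h)
  · exact mul_eq_zero_of_left
      (hatFn_eq_zero_of_ge (hu j (by omega)) (hmid.trans h)) _

/-- The second moment of a sum of functions of independent coordinates. -/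
theorem integral_sq_sum_eval_pi {ι : Type*} [Fintype ι] {Ω : ι → Type*}
    [∀ i, MeasurableSpace (Ω i)] {μ : ∀ i, Measure (Ω i)} [∀ i, IsProbabilityMeasure (μ i)]
    {X : ∀ i, Ω i → ℝ} (h : ∀ i, MemLp (X i) 2 (μ i)) :
    ∫ ω, (∑ i, X i (ω i)) ^ 2 ∂Measure.pi μ =
      ∑ i, (∫ ω, X i ω ^ 2 ∂μ i - (∫ ω, X i ω ∂μ i) ^ 2) + (∑ i, ∫ ω, X i ω ∂μ i) ^ 2 := by
  have hcomp : ∀ i, MemLp (fun ω : ∀ i, Ω i => X i (ω i)) 2 (Measure.pi μ) := fun i =>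
    (h i).comp_measurePreserving (measurePreserving_eval μ i)
  have hvar := ProbabilityTheory.variance_sum_pi h
  rw [ProbabilityTheory.variance_eq_sub (memLp_finsetSum' _ fun i _ => hcomp i)] at hvar
  have hmean : ∫ ω, ∑ i, X i (ω i) ∂Measure.pi μ = ∑ i, ∫ ω, X i ω ∂μ i := by
    rw [integral_finsetSum _ fun i _ => (hcomp i).integrable one_le_two]
    exact Finset.sum_congr rfl fun i _ => integral_comp_eval (h i).aestronglyMeasurable
  simp only [ProbabilityTheory.variance_eq_sub (h _), Pi.pow_apply, Finset.sum_apply,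
    hmean] at hvar
  linarith

theorem integral_sq_sum_mul {α κ : Type*} [MeasurableSpace α] {μ : Measure α}
    (s : Finset κ) (c : κ → ℝ) {f : κ → α → ℝ} (hf : ∀ k ∈ s, MemLp (f k) 2 μ) :
    ∫ t, (∑ k ∈ s, c k * f k t) ^ 2 ∂μ =
      ∑ k ∈ s, ∑ l ∈ s, c k * c l * ∫ t, f k t * f l t ∂μ := by
  have hint : ∀ k ∈ s, ∀ l ∈ s, Integrable (fun t => c k * c l * (f k t * f l t)) μ :=
    fun k hk l hl => ((hf k hk).integrable_mul (hf l hl)).const_mul _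
  simp only [pow_two, Finset.sum_mul_sum, mul_mul_mul_comm (c _) (f _ _)]
  rw [integral_finsetSum _ fun k hk => integrable_finsetSum _ (hint k hk)]
  refine Finset.sum_congr rfl fun k hk => ?_
  rw [integral_finsetSum _ (hint k hk)]
  exact Finset.sum_congr rfl fun l _ => integral_const_mul _ _

theorem volume_restrict_Icc_zero_one_pi (ι : Type*) [Fintype ι] :
    (volume : Measure (ι → ℝ)).restrict (Set.Icc 0 1) =
      Measure.pi fun _ => (volume : Measure ℝ).restrict (Set.Icc 0 1) := by
  rw [← Set.pi_univ_Icc, volume_pi, Measure.restrict_pi_pi]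
  rfl

instance isProbabilityMeasure_restrict_Icc_zero_one :
    IsProbabilityMeasure ((volume : Measure ℝ).restrict (Set.Icc 0 1)) :=
  ⟨by simp⟩

/-- Proposition 1: analytic expression of the squared-norm criterion when adding
a new variable `istar`. The set of current active variables is `J = univ.erase istar`
so that the cube `[0,1]^(|J|+1)` has coordinates indexed by `J ∪ {istar}` = all of `ι`. -/
theorem stmt10 (ι : Type) [Fintype ι] [DecidableEq ι] (istar : ι)
    (m : ι → ℕ) (u : ι → ℕ → ℝ)
    (hm : ∀ i ∈ Finset.univ.erase istar, 2 ≤ m i)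
    (hu0 : ∀ i ∈ Finset.univ.erase istar, u i 0 = -1)
    (hu1 : ∀ i ∈ Finset.univ.erase istar, u i 1 = 0)
    (hum : ∀ i ∈ Finset.univ.erase istar, u i (m i) = 1)
    (hum1 : ∀ i ∈ Finset.univ.erase istar, u i (m i + 1) = 2)
    (humono : ∀ i ∈ Finset.univ.erase istar, ∀ j, 1 ≤ j → j < m i → u i j < u i (j + 1))
    (η : ι → ℕ → ℝ) (ξ1 ξ2 : ℝ)
    (E : ι → ℕ → ℝ) (E2 : ι → ℕ → ℕ → ℝ)
    (hE : ∀ i j, E i j = ∫ s in (0:ℝ)..1, hatBasis (u i) j s)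
    (hE2 : ∀ i j j', E2 i j j' =
      ∫ s in (0:ℝ)..1, hatBasis (u i) j s * hatBasis (u i) j' s) :
    ∫ x in Set.Icc (0 : ι → ℝ) 1,
        ((∑ i ∈ Finset.univ.erase istar,
            ∑ j ∈ Finset.Icc 1 (m i), η i j * hatBasis (u i) j (x i))
          - (ξ1 * (1 - x istar) + ξ2 * x istar)) ^ 2
      = (∑ i ∈ Finset.univ.erase istar,
          ∑ j ∈ Finset.Icc 1 (m i),
            ∑ j' ∈ (Finset.Icc 1 (m i)).filter (fun j' => j' ≤ j + 1 ∧ j ≤ j' + 1),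
              η i j * η i j' * E2 i j j')
        - (∑ i ∈ Finset.univ.erase istar,
            (∑ j ∈ Finset.Icc 1 (m i), η i j * E i j) ^ 2)
        + (ξ2 - ξ1) ^ 2 / 12
        + ((∑ i ∈ Finset.univ.erase istar, ∑ j ∈ Finset.Icc 1 (m i), η i j * E i j)
            - (ξ1 + ξ2) / 2) ^ 2 := by
  have hEi : ∀ f : ℝ → ℝ, ∫ s in (0 : ℝ)..1, f s = ∫ s in Set.Icc (0 : ℝ) 1, f s := fun f => by
    rw [intervalIntegral.integral_of_le zero_le_one, integral_Icc_eq_integral_Ioc]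
  have hstrict : ∀ i ∈ Finset.univ.erase istar, ∀ l < m i + 1, u i l < u i (l + 1) := by
    intro i hi l hl
    rcases Nat.eq_zero_or_pos l with rfl | hl0
    · rw [hu0 i hi, hu1 i hi]; norm_num
    · rcases Nat.lt_succ_iff_lt_or_eq.mp hl with h | rfl
      · exact humono i hi l hl0 h
      · rw [hum i hi, hum1 i hi]; norm_num
  let X : ι → ℝ → ℝ := fun i t =>
    if i = istar then -(ξ1 * (1 - t) + ξ2 * t)
    else ∑ j ∈ Finset.Icc 1 (m i), η i j * hatBasis (u i) j t
  have hXstar : ∀ t, X istar t = -(ξ1 * (1 - t) + ξ2 * t) := fun t => if_pos rfl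
  have hXne : ∀ i ∈ Finset.univ.erase istar, ∀ t,
      X i t = ∑ j ∈ Finset.Icc 1 (m i), η i j * hatBasis (u i) j t :=
    fun i hi t => if_neg (Finset.ne_of_mem_erase hi)
  have hX : ∀ i, MemLp (X i) 2 (volume.restrict (Set.Icc (0 : ℝ) 1)) := by
    intro i
    by_cases hi : i = istar
    · subst hi
      have hc : Continuous fun t : ℝ => -(ξ1 * (1 - t) + ξ2 * t) := by fun_prop
      rw [funext hXstar]
      obtain ⟨C, hC⟩ := isCompact_Icc.exists_bound_of_continuousOn
        (hc.continuousOn (s := Set.Icc 0 1))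
      exact MemLp.of_bound hc.aestronglyMeasurable C
        ((ae_restrict_iff' measurableSet_Icc).mpr (Filter.Eventually.of_forall hC))
    · rw [funext (hXne i (by simp [hi]))]
      exact memLp_finsetSum _ fun j _ => (memLp_hatBasis _ _ _ _).const_mul _
  have hsum : ∀ x : ι → ℝ, (∑ i ∈ Finset.univ.erase istar,
            ∑ j ∈ Finset.Icc 1 (m i), η i j * hatBasis (u i) j (x i))
          - (ξ1 * (1 - x istar) + ξ2 * x istar) = ∑ i, X i (x i) := fun x => by
    rw [← Finset.sum_erase_add _ _ (Finset.mem_univ istar), hXstar, sub_eq_add_neg]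
    congr 1
    exact Finset.sum_congr rfl fun i hi => (hXne i hi _).symm
  have hmean : ∀ i ∈ Finset.univ.erase istar, ∫ t in Set.Icc (0 : ℝ) 1, X i t =
      ∑ j ∈ Finset.Icc 1 (m i), η i j * E i j := fun i hi => by
    simp only [hXne i hi, hE, hEi]
    rw [integral_finsetSum _ fun j _ =>
      ((memLp_hatBasis (u i) j 1 _).integrable le_rfl).const_mul _]
    simp only [integral_const_mul]
  have hsq : ∀ i ∈ Finset.univ.erase istar, ∫ t in Set.Icc (0 : ℝ) 1, X i t ^ 2 =
      ∑ j ∈ Finset.Icc 1 (m i),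
        ∑ j' ∈ (Finset.Icc 1 (m i)).filter (fun j' => j' ≤ j + 1 ∧ j ≤ j' + 1),
          η i j * η i j' * E2 i j j' := fun i hi => by
    simp only [hXne i hi, hE2, hEi]
    rw [integral_sq_sum_mul _ _ fun j _ => memLp_hatBasis (u i) j 2 _]
    refine Finset.sum_congr rfl fun j hj => (Finset.sum_filter_of_ne fun j' hj' hne => ?_).symm
    rw [Finset.mem_Icc] at hj hj'
    by_contra hfar
    refine hne (mul_eq_zero_of_right _ ?_)
    rcases not_and_or.mp hfar with h | h
    · simp only [hatBasis_mul_hatBasis_eq_zero (hstrict i hi) hj.1 (by omega : j + 2 ≤ j')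
        (by omega), integral_zero]
    · simp only [mul_comm (hatBasis (u i) j _), hatBasis_mul_hatBasis_eq_zero (hstrict i hi) hj'.1
        (by omega : j' + 2 ≤ j) (by omega), integral_zero]
  have hmeanStar : ∫ t in Set.Icc (0 : ℝ) 1, X istar t = -((ξ1 + ξ2) / 2) := by
    have hpt : ∀ t : ℝ, -(ξ1 * (1 - t) + ξ2 * t) = (ξ1 - ξ2) * t - ξ1 := fun t => by ring
    simp only [hXstar, hpt, ← hEi]
    rw [intervalIntegral.integral_sub (Continuous.intervalIntegrable (by fun_prop) _ _)
      (by simp), intervalIntegral.integral_const_mul, integral_id]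
    simp
    ring
  have hsqStar : ∫ t in Set.Icc (0 : ℝ) 1, X istar t ^ 2 =
      (ξ2 - ξ1) ^ 2 / 12 + ((ξ1 + ξ2) / 2) ^ 2 := by
    have hder : ∀ t ∈ Set.uIcc (0 : ℝ) 1, HasDerivAt
        (fun t => (ξ1 - ξ2) ^ 2 * (t ^ 3 / 3) - (ξ1 - ξ2) * ξ1 * t ^ 2 + ξ1 ^ 2 * t)
        ((-(ξ1 * (1 - t) + ξ2 * t)) ^ 2) t := fun t _ => by
      refine HasDerivAt.congr_deriv (((((hasDerivAt_pow 3 t).div_const 3).const_mul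
        ((ξ1 - ξ2) ^ 2)).sub ((hasDerivAt_pow 2 t).const_mul ((ξ1 - ξ2) * ξ1))).add
        ((hasDerivAt_id' t).const_mul (ξ1 ^ 2))) ?_
      norm_num
      ring
    simp only [hXstar, ← hEi]
    rw [intervalIntegral.integral_eq_sub_of_hasDerivAt hder
      (Continuous.intervalIntegrable (by fun_prop) _ _)]
    ring
  simp only [hsum]
  rw [volume_restrict_Icc_zero_one_pi, integral_sq_sum_eval_pi hX]
  simp only [← Finset.sum_erase_add _ _ (Finset.mem_univ istar)]
  rw [hmeanStar, hsqStar, Finset.sum_congr rfl hmean,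
    Finset.sum_congr rfl fun i hi => by rw [hsq i hi, hmean i hi], Finset.sum_sub_distrib]
  ring
end
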